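/- arXiv:2101.11947 — 6 statements merged into one kernel-verified Lean document; each statement's English description precedes it below -/
import Mathlib

section
/- Let k ≥ 2 and n ≥ d ≥ 1 be integers with n ≥ ⌊log₂ k⌋ + d + 1. Then f(n,k,d) ≥ n + 2^d·k − d − log₂(2k), where the inequality is between real numbers and log₂ denotes the base-2 logarithm. -/
open scoped Classical

noncomputable section

abbrev F2 : Type := ZMod 2

/-- Number of members of the multiset `H` (counted with multiplicity) containing `x`. -/
def covCount (n : ℕ) (H : Multiset (AffineSubspace F2 (Fin n → F2))) (x : Fin n → F2) : ℕ :=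
  Multiset.countP (fun S => x ∈ S) H

/-- `H` is a (k,d)-cover of 𝔽₂ⁿ: a multiset of (n-d)-dimensional affine subspaces covering
every nonzero point at least `k` times and the origin at most `k-1` times. -/
def IsCover (n k d : ℕ) (H : Multiset (AffineSubspace F2 (Fin n → F2))) : Prop :=
  (∀ S ∈ H, (S : Set (Fin n → F2)).Nonempty ∧ Module.finrank F2 S.direction = n - d) ∧
  (∀ x : Fin n → F2, x ≠ 0 → k ≤ covCount n H x) ∧
  covCount n H 0 < k

/-- `H` is a (k,d;s)-cover of 𝔽₂ⁿ: a (k,d)-cover in which the origin lies in exactly `s`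
members (counted with multiplicity). -/
def IsCoverExact (n k d s : ℕ) (H : Multiset (AffineSubspace F2 (Fin n → F2))) : Prop :=
  (∀ S ∈ H, (S : Set (Fin n → F2)).Nonempty ∧ Module.finrank F2 S.direction = n - d) ∧
  (∀ x : Fin n → F2, x ≠ 0 → k ≤ covCount n H x) ∧
  covCount n H 0 = s

/-- Minimum cardinality of a (k,d)-cover of 𝔽₂ⁿ. -/
def f (n k d : ℕ) : ℕ := sInf {m | ∃ H, IsCover n k d H ∧ Multiset.card H = m}

/-- Minimum cardinality of a (k,d;s)-cover of 𝔽₂ⁿ. -/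
def g (n k d s : ℕ) : ℕ := sInf {m | ∃ H, IsCoverExact n k d s H ∧ Multiset.card H = m}

end

namespace CoverProof

open Module

lemma f2_cases (a : F2) : a = 0 ∨ a = 1 := by
  revert a; decide

section
variable {V : Type} [AddCommGroup V] [Module F2 V] [FiniteDimensional F2 V]

lemma finrank_inf_ker (D : Submodule F2 V) (ψ : V →ₗ[F2] F2) (v : V) (hv : v ∈ D)
    (hψ : ψ v = 1) :
    finrank F2 (D ⊓ LinearMap.ker ψ : Submodule F2 V) + 1 = finrank F2 D := by
  have h := (ψ.domRestrict D).finrank_range_add_finrank_ker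
  have hs : LinearMap.range (ψ.domRestrict D) = ⊤ := by
    rw [LinearMap.range_eq_top]
    intro c
    refine ⟨c • ⟨v, hv⟩, ?_⟩
    simp [hψ]
  rw [hs, finrank_top, finrank_self] at h
  have hk : finrank F2 (LinearMap.ker (ψ.domRestrict D))
      = finrank F2 (D ⊓ LinearMap.ker ψ : Submodule F2 V) := by
    rw [LinearEquiv.finrank_eq (Submodule.equivMapOfInjective D.subtype
      (Submodule.injective_subtype D) (LinearMap.ker (ψ.domRestrict D)))]
    have hm : Submodule.map D.subtype (LinearMap.ker (ψ.domRestrict D))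
        = D ⊓ LinearMap.ker ψ := by
      ext x
      simp [LinearMap.mem_ker, and_comm]
    rw [hm]
  omega

lemma exists_functional_of_notMem (D : Submodule F2 V) (x : V) (hx : x ∉ D) :
    ∃ ψ : V →ₗ[F2] F2, ψ x = 1 ∧ ∀ y ∈ D, ψ y = 0 := by
  obtain ⟨ψ, h1, h2⟩ := Submodule.exists_le_ker_of_notMem hx
  refine ⟨ψ, (f2_cases _).resolve_left h1, fun y hy => by simpa using h2 hy⟩

/-- Existence of subspaces of every dimension avoiding a given nonzero vector. -/
lemma exists_subspace (x : V) (hx : x ≠ 0) (d : ℕ) (hd : 1 ≤ d) (hdn : d ≤ finrank F2 V) :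
    ∃ D : Submodule F2 V, x ∉ D ∧ finrank F2 D = finrank F2 V - d := by
  induction d, hd using Nat.le_induction with
  | base =>
    obtain ⟨ψ, h1, -⟩ := exists_functional_of_notMem (⊥ : Submodule F2 V) x (by simpa using hx)
    refine ⟨⊤ ⊓ LinearMap.ker ψ, by simp [h1], ?_⟩
    have := finrank_inf_ker ⊤ ψ x trivial h1
    rw [finrank_top] at this
    omega
  | succ m hm ih =>
    obtain ⟨D, hD, hf⟩ := ih (by omega)
    have : D ≠ ⊥ := by
      rintro rfl
      rw [finrank_bot] at hf
      omega
    obtain ⟨v, hv, hv0⟩ := Submodule.exists_mem_ne_zero_of_ne_bot this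
    obtain ⟨ψ, h1, -⟩ := exists_functional_of_notMem (⊥ : Submodule F2 V) v (by simpa using hv0)
    refine ⟨D ⊓ LinearMap.ker ψ, fun h => hD h.1, ?_⟩
    have := finrank_inf_ker D ψ v hv h1
    omega

/-- multiplicity of a point -/
noncomputable def cnt (H : Multiset (AffineSubspace F2 V)) (x : V) : ℕ :=
  Multiset.countP (fun S => x ∈ S) H

lemma card_eq (S : AffineSubspace F2 V) [Fintype V] (hS : (S : Set V).Nonempty) :
    (∑ x : V, if x ∈ S then 1 else 0) = 2 ^ finrank F2 S.direction := by
  obtain ⟨p, hp⟩ := hS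
  have h2 : Fintype.card S.direction = 2 ^ finrank F2 S.direction := by
    have := Module.card_eq_pow_finrank (K := F2) (V := S.direction)
    simpa [ZMod.card] using this
  rw [← h2, Finset.sum_boole, Nat.cast_id, Fintype.card_subtype]
  refine Finset.card_bij' (fun x _ => x - p) (fun v _ => v + p) ?_ ?_ ?_ ?_
  · intro x hx
    simp only [Finset.mem_filter, Finset.mem_univ, true_and] at hx ⊢
    exact AffineSubspace.vsub_mem_direction hx hp
  · intro x hx
    simp only [Finset.mem_filter, Finset.mem_univ, true_and] at hx ⊢
    exact AffineSubspace.vadd_mem_of_mem_direction hx hp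
  · intros; simp
  · intros; simp

lemma sum_cnt [Fintype V] (t : ℕ) (H : Multiset (AffineSubspace F2 V))
    (hH : ∀ S ∈ H, (S : Set V).Nonempty ∧ finrank F2 S.direction = t) :
    ∑ x : V, cnt H x = Multiset.card H * 2 ^ t := by
  induction H using Multiset.induction with
  | empty => simp [cnt]
  | cons S H ih =>
    have h1 := ih (fun T hT => hH T (Multiset.mem_cons_of_mem hT))
    have h2 := hH S (Multiset.mem_cons_self S H)
    have h3 := card_eq S h2.1
    rw [h2.2] at h3
    simp only [cnt, Multiset.countP_cons, Finset.sum_add_distrib, Multiset.card_cons] at h1 ⊢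
    rw [h1, h3]
    ring

structure IsCov (k d : ℕ) (H : Multiset (AffineSubspace F2 V)) : Prop where
  mem : ∀ S ∈ H, (S : Set V).Nonempty ∧ finrank F2 S.direction + d = finrank F2 V
  cov : ∀ x : V, x ≠ 0 → k ≤ cnt H x
  zero : cnt H 0 < k

lemma double_count {k d : ℕ} {H : Multiset (AffineSubspace F2 V)} (h : IsCov k d H)
    (hd : d ≤ finrank F2 V) :
    k * 2 ^ finrank F2 V + cnt H 0 ≤ Multiset.card H * 2 ^ (finrank F2 V - d) + k := by
  have : Finite V := Module.finite_of_finite F2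
  have := Fintype.ofFinite V
  rw [← sum_cnt (finrank F2 V - d) H
    (fun S hS => ⟨(h.mem S hS).1, by have := (h.mem S hS).2; omega⟩)]
  have hc : Fintype.card V = 2 ^ finrank F2 V := by
    have := Module.card_eq_pow_finrank (K := F2) (V := V)
    simpa [ZMod.card] using this
  have h1 : ∑ x ∈ Finset.univ.erase (0 : V), k ≤ ∑ x ∈ Finset.univ.erase (0 : V), cnt H x :=
    Finset.sum_le_sum (fun x hx => h.cov x (Finset.ne_of_mem_erase hx))
  have h2 := Finset.sum_erase_add Finset.univ (fun x => cnt H x) (Finset.mem_univ (0 : V))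
  have h3 := Finset.sum_erase_add Finset.univ (fun _ => k) (Finset.mem_univ (0 : V))
  simp only [Finset.sum_const, Finset.card_univ, hc, smul_eq_mul] at h1 h2 h3
  rw [← h2, mul_comm k, ← h3]
  omega

lemma card_gt {k d : ℕ} {H : Multiset (AffineSubspace F2 V)} (h : IsCov k d H)
    (hd : d < finrank F2 V) : 2 ^ d * cnt H 0 < Multiset.card H := by
  have h1 := double_count h hd.le
  have h2 := h.zero
  have h3 : 2 ^ finrank F2 V = 2 ^ d * 2 ^ (finrank F2 V - d) := by
    rw [← pow_add]; congr 1; omega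
  have h4 : 1 < 2 ^ finrank F2 V := Nat.one_lt_two_pow (by omega)
  have h5 : cnt H 0 * 2 ^ finrank F2 V < Multiset.card H * 2 ^ (finrank F2 V - d) := by
    obtain ⟨j, hj⟩ := Nat.exists_eq_add_of_lt h2
    rw [hj] at h1
    nlinarith
  rw [h3] at h5
  have : (2 ^ d * cnt H 0) * 2 ^ (finrank F2 V - d)
    < Multiset.card H * 2 ^ (finrank F2 V - d) := by linarith
  exact lt_of_mul_lt_mul_right this (Nat.zero_le _)

/-- `+1` if the hyperplane `ker φ` misses `S`, `-1` if it contains `S`, `0` otherwise. -/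
noncomputable def e (S : AffineSubspace F2 V) (φ : V →ₗ[F2] F2) : ℤ :=
  if ∀ x ∈ S, φ x = 1 then 1 else if ∀ x ∈ S, φ x = 0 then -1 else 0

lemma e_zero (S : AffineSubspace F2 V) (hS : (S : Set V).Nonempty) : e S 0 = -1 := by
  obtain ⟨p, hp⟩ := hS
  rw [e, if_neg, if_pos]
  · simp
  · intro h; simpa using h p hp

lemma e_sum [Fintype (V →ₗ[F2] F2)] (S : AffineSubspace F2 V) (d : ℕ)
    (hS : (S : Set V).Nonempty)
    (hd : finrank F2 S.direction + d = finrank F2 V) :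
    ∑ φ : V →ₗ[F2] F2, e S φ = if (0 : V) ∈ S then -(2 ^ d : ℤ) else 0 := by
  obtain ⟨p, hp⟩ := hS
  have hconst : ∀ φ : V →ₗ[F2] F2, ∀ c : F2,
      (∀ x ∈ S, φ x = c) ↔ (φ ∈ S.direction.dualAnnihilator ∧ φ p = c) := by
    intro φ c
    rw [Submodule.mem_dualAnnihilator]
    constructor
    · intro h
      refine ⟨fun w hw => ?_, h p hp⟩
      have := h _ (AffineSubspace.vadd_mem_of_mem_direction hw hp)
      rw [vadd_eq_add, map_add, h p hp] at this
      simpa using this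
    · rintro ⟨h1, h2⟩ x hx
      have := h1 _ (AffineSubspace.vsub_mem_direction hx hp)
      rw [vsub_eq_sub, map_sub, h2, sub_eq_zero] at this
      exact this
  split_ifs with h0
  · have hcard : Fintype.card S.direction.dualAnnihilator = 2 ^ d := by
      have h1 := Module.card_eq_pow_finrank (K := F2) (V := S.direction.dualAnnihilator)
      have h2 := Subspace.finrank_add_finrank_dualAnnihilator_eq S.direction
      have h3 : finrank F2 S.direction.dualAnnihilator = d := by omega
      rw [h3] at h1
      simpa [ZMod.card] using h1
    have he : ∀ φ : V →ₗ[F2] F2, e S φ =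
        if φ ∈ S.direction.dualAnnihilator then -1 else 0 := by
      intro φ
      rw [e, if_neg (fun h => by simpa using h 0 h0)]
      by_cases hφ : φ ∈ S.direction.dualAnnihilator
      · rw [if_pos hφ, if_pos]
        rw [hconst]
        refine ⟨hφ, ?_⟩
        have := (Submodule.mem_dualAnnihilator _).1 hφ _ (AffineSubspace.vsub_mem_direction hp h0)
        simpa using this
      · rw [if_neg hφ, if_neg]
        rw [hconst]
        tauto
    simp_rw [he]
    rw [← Finset.sum_filter, Finset.sum_const, ← Fintype.card_subtype]
    have : (Fintype.card {x // x ∈ S.direction.dualAnnihilator}) = 2 ^ d := by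
      rw [← hcard]
    rw [this]
    simp
  · have hpd : p ∉ S.direction := by
      intro h
      apply h0
      have := AffineSubspace.vadd_mem_of_mem_direction (S.direction.neg_mem h) hp
      simpa using this
    obtain ⟨ψ, hψ1, hψ2⟩ := exists_functional_of_notMem _ _ hpd
    have hψ : ψ ∈ S.direction.dualAnnihilator := (Submodule.mem_dualAnnihilator _).2 hψ2
    have hneg : ∀ φ, e S (φ + ψ) = - e S φ := by
      intro φ
      have hm : φ + ψ ∈ S.direction.dualAnnihilator ↔ φ ∈ S.direction.dualAnnihilator :=
        Submodule.add_mem_iff_left _ hψ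
      simp only [e, hconst]
      simp only [hm, LinearMap.add_apply, hψ1]
      by_cases hφ : φ ∈ S.direction.dualAnnihilator
      · rcases f2_cases (φ p) with h | h
        · simp [hφ, h]
        · have : (1 + 1 : F2) = 0 := by decide
          simp [hφ, h, this]
      · simp [hφ]
    have h1 : ∑ φ, e S (φ + ψ) = ∑ φ, e S φ :=
      Fintype.sum_equiv (Equiv.addRight ψ) _ _ (fun _ => rfl)
    simp_rw [hneg, Finset.sum_neg_distrib] at h1
    omega

lemma e_total [Fintype (V →ₗ[F2] F2)] (d : ℕ) (H : Multiset (AffineSubspace F2 V))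
    (hH : ∀ S ∈ H, (S : Set V).Nonempty ∧ finrank F2 S.direction + d = finrank F2 V) :
    ∑ φ : V →ₗ[F2] F2, (H.map (fun S => e S φ)).sum = -(2 ^ d * cnt H 0 : ℤ) ∧
    (H.map (fun S => e S 0)).sum = -(Multiset.card H : ℤ) := by
  induction H using Multiset.induction with
  | empty => simp [cnt]
  | cons S H ih =>
    obtain ⟨h1, h1'⟩ := ih (fun T hT => hH T (Multiset.mem_cons_of_mem hT))
    have h2 := hH S (Multiset.mem_cons_self S H)
    have h3 := e_sum S d h2.1 h2.2
    constructor
    · simp only [cnt, Multiset.countP_cons, Finset.sum_add_distrib, Multiset.map_cons,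
        Multiset.sum_cons] at h1 ⊢
      rw [h1, h3]
      split_ifs <;> push_cast <;> ring
    · simp only [Multiset.map_cons, Multiset.sum_cons, Multiset.card_cons]
      rw [h1', e_zero S h2.1]
      push_cast; ring

lemma exists_good {k d : ℕ} {H : Multiset (AffineSubspace F2 V)} (h : IsCov k d H)
    (hd : d < finrank F2 V) :
    ∃ φ : V →ₗ[F2] F2, φ ≠ 0 ∧ 0 < (H.map (fun S => e S φ)).sum := by
  have : Finite V := Module.finite_of_finite F2
  have : Finite (V →ₗ[F2] F2) := Module.finite_of_finite F2
  have := Fintype.ofFinite (V →ₗ[F2] F2)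
  obtain ⟨h1, h2⟩ := e_total d H h.mem
  have h3 := Finset.sum_erase_add Finset.univ (fun φ : V →ₗ[F2] F2 => (H.map (fun S => e S φ)).sum)
    (Finset.mem_univ 0)
  have h4 : (2 ^ d * cnt H 0 : ℤ) < Multiset.card H := by exact_mod_cast card_gt h hd
  have h5 : 0 < ∑ φ ∈ Finset.univ.erase (0 : V →ₗ[F2] F2), (H.map (fun S => e S φ)).sum := by
    simp only [h1, h2] at h3
    linarith
  obtain ⟨φ, hφ, hpos⟩ := Finset.exists_lt_of_sum_lt (s := Finset.univ.erase (0 : V →ₗ[F2] F2))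
    (f := fun _ => (0 : ℤ)) (g := fun φ => (H.map (fun S => e S φ)).sum) (by simpa using h5)
  exact ⟨φ, Finset.ne_of_mem_erase hφ, hpos⟩

lemma slice (S : AffineSubspace F2 V) (ψ : V →ₗ[F2] F2) (p v : V) (hp : p ∈ S)
    (hv : v ∈ S.direction) (hψ : ψ v = 1) (c : F2) :
    ∃ T : AffineSubspace F2 V, (T : Set V).Nonempty ∧
      finrank F2 T.direction + 1 = finrank F2 S.direction ∧
      ∀ x, x ∈ T ↔ (x ∈ S ∧ ψ x = c) := by
  have hq : (c - ψ p) • v + p ∈ S :=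
    AffineSubspace.vadd_mem_of_mem_direction (S.direction.smul_mem _ hv) hp
  have hqc : ψ ((c - ψ p) • v + p) = c := by simp [hψ]
  generalize (c - ψ p) • v + p = q at hq hqc
  refine ⟨AffineSubspace.mk' q (S.direction ⊓ LinearMap.ker ψ), ⟨q, AffineSubspace.self_mem_mk' _ _⟩,
    ?_, ?_⟩
  · rw [AffineSubspace.direction_mk']
    exact finrank_inf_ker _ _ v hv hψ
  · intro x
    rw [AffineSubspace.mem_mk', Submodule.mem_inf, LinearMap.mem_ker, vsub_eq_sub, map_sub, hqc,
      sub_eq_zero, ← vsub_eq_sub, AffineSubspace.vsub_right_mem_direction_iff_mem hq]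

lemma restrict (φ : V →ₗ[F2] F2) (S : AffineSubspace F2 V) (p : V) (hp : p ∈ S) (hφ : φ p = 0) :
    ∃ T : AffineSubspace F2 (LinearMap.ker φ), (T : Set (LinearMap.ker φ)).Nonempty ∧
      finrank F2 T.direction = finrank F2 (S.direction ⊓ LinearMap.ker φ : Submodule F2 V) ∧
      ∀ x : LinearMap.ker φ, x ∈ T ↔ (x : V) ∈ S := by
  refine ⟨AffineSubspace.mk' ⟨p, hφ⟩ (S.direction.comap (LinearMap.ker φ).subtype),
    ⟨_, AffineSubspace.self_mem_mk' _ _⟩, ?_, ?_⟩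
  · rw [AffineSubspace.direction_mk']
    rw [LinearEquiv.finrank_eq (Submodule.equivMapOfInjective (LinearMap.ker φ).subtype
      (Submodule.injective_subtype _) (S.direction.comap (LinearMap.ker φ).subtype))]
    rw [Submodule.map_comap_subtype, inf_comm]
  · intro x
    rw [AffineSubspace.mem_mk', Submodule.mem_comap]
    exact AffineSubspace.vsub_right_mem_direction_iff_mem hp _

lemma piece (φ : V →ₗ[F2] F2) (hφ : φ ≠ 0) (d : ℕ) (hd : d < finrank F2 V)
    (S : AffineSubspace F2 V)
    (hS : (S : Set V).Nonempty ∧ finrank F2 S.direction + d = finrank F2 V) :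
    ∃ m : Multiset (AffineSubspace F2 (LinearMap.ker φ)),
      (Multiset.card m : ℤ) = 1 - e S φ ∧
      (∀ T ∈ m, (T : Set (LinearMap.ker φ)).Nonempty ∧
        finrank F2 T.direction + d + 1 = finrank F2 V) ∧
      ∀ x : LinearMap.ker φ, cnt m x = if (x : V) ∈ S then 1 else 0 := by
  obtain ⟨⟨p, hp⟩, hdim⟩ := hS
  by_cases h1 : ∀ x ∈ S, φ x = 1
  · refine ⟨0, by simp [e, if_pos h1], by simp, fun x => ?_⟩
    rw [if_neg]
    · simp [cnt]
    · intro hx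
      have := h1 _ hx
      rw [LinearMap.mem_ker.1 x.2] at this
      simp at this
  by_cases h0 : ∀ x ∈ S, φ x = 0
  · obtain ⟨T, ⟨q, hq⟩, hT, hmem⟩ := restrict φ S p hp (h0 p hp)
    have hle : S.direction ⊓ LinearMap.ker φ = S.direction := by
      refine inf_eq_left.2 (fun v hv => ?_)
      have := h0 _ (AffineSubspace.vadd_mem_of_mem_direction hv hp)
      rw [vadd_eq_add, map_add, h0 p hp, add_zero] at this
      exact this
    rw [hle] at hT
    have hne : T.direction ≠ ⊥ := by
      intro h
      rw [h, finrank_bot] at hT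
      omega
    obtain ⟨v, hv, hv0⟩ := Submodule.exists_mem_ne_zero_of_ne_bot hne
    obtain ⟨ψ, hψ, -⟩ := exists_functional_of_notMem (⊥ : Submodule F2 (LinearMap.ker φ)) v
      (by simpa using hv0)
    obtain ⟨A, hA, hA1, hA2⟩ := slice T ψ q v hq hv hψ 0
    obtain ⟨B, hB, hB1, hB2⟩ := slice T ψ q v hq hv hψ 1
    refine ⟨{A, B}, ?_, ?_, ?_⟩
    · simp [e, if_neg h1, if_pos h0]
    · intro X hX
      simp only [Multiset.insert_eq_cons, Multiset.mem_cons, Multiset.mem_singleton] at hX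
      rcases hX with rfl | rfl
      · exact ⟨hA, by omega⟩
      · exact ⟨hB, by omega⟩
    · intro x
      rw [← hmem x]
      simp only [cnt, Multiset.insert_eq_cons, ← Multiset.cons_zero, Multiset.countP_cons,
        Multiset.countP_zero, hA2, hB2]
      by_cases hx : x ∈ T
      · rcases f2_cases (ψ x) with h | h <;> simp [hx, h]
      · simp [hx]
  · have h1' := h1
    have h0' := h0
    push Not at h1 h0
    obtain ⟨x, hx, hx1⟩ := h1
    obtain ⟨y, hy, hy0⟩ := h0
    have hx0 := (f2_cases (φ x)).resolve_right hx1
    have hy1 := (f2_cases (φ y)).resolve_left hy0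
    obtain ⟨T, hTn, hT, hmem⟩ := restrict φ S x hx hx0
    have := finrank_inf_ker S.direction φ (y - x) (AffineSubspace.vsub_mem_direction hy hx)
      (by simp [hx0, hy1])
    refine ⟨{T}, ?_, ?_, ?_⟩
    · simp [e, if_neg h1', if_neg h0']
    · intro X hX
      rw [Multiset.mem_singleton] at hX
      subst hX
      exact ⟨hTn, by omega⟩
    · intro z
      rw [← hmem z]
      simp [cnt, ← Multiset.cons_zero, Multiset.countP_cons]

lemma pieces (φ : V →ₗ[F2] F2) (hφ : φ ≠ 0) (d : ℕ) (hd : d < finrank F2 V)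
    (H : Multiset (AffineSubspace F2 V))
    (hH : ∀ S ∈ H, (S : Set V).Nonempty ∧ finrank F2 S.direction + d = finrank F2 V) :
    ∃ m : Multiset (AffineSubspace F2 (LinearMap.ker φ)),
      (Multiset.card m : ℤ) = Multiset.card H - (H.map (fun S => e S φ)).sum ∧
      (∀ T ∈ m, (T : Set (LinearMap.ker φ)).Nonempty ∧
        finrank F2 T.direction + d + 1 = finrank F2 V) ∧
      ∀ x : LinearMap.ker φ, cnt m x = cnt H (x : V) := by
  induction H using Multiset.induction with
  | empty => exact ⟨0, by simp, by simp, by simp [cnt]⟩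
  | cons S H ih =>
    obtain ⟨m, hm1, hm2, hm3⟩ := ih (fun T hT => hH T (Multiset.mem_cons_of_mem hT))
    obtain ⟨r, hr1, hr2, hr3⟩ := piece φ hφ d hd S (hH S (Multiset.mem_cons_self S H))
    refine ⟨m + r, ?_, ?_, ?_⟩
    · simp only [Multiset.card_add, Multiset.card_cons, Multiset.map_cons, Multiset.sum_cons]
      push_cast
      linarith
    · intro T hT
      rcases Multiset.mem_add.1 hT with h | h
      · exact hm2 T h
      · exact hr2 T h
    · intro x
      have h1 := hm3 x
      have h2 := hr3 x
      simp only [cnt, Multiset.countP_add, Multiset.countP_cons] at h1 h2 ⊢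
      rw [h1, h2]

end

lemma descend {V : Type} [AddCommGroup V] [Module F2 V] [FiniteDimensional F2 V]
    {k d : ℕ} {H : Multiset (AffineSubspace F2 V)} (h : IsCov k d H)
    (hd : d < finrank F2 V) :
    ∃ (W : Submodule F2 V) (m : Multiset (AffineSubspace F2 W)),
      finrank F2 W + 1 = finrank F2 V ∧ IsCov k d m ∧ Multiset.card m + 1 ≤ Multiset.card H := by
  obtain ⟨φ, hφ, hpos⟩ := exists_good h hd
  obtain ⟨m, hm1, hm2, hm3⟩ := pieces φ hφ d hd H h.mem
  have hW : finrank F2 (LinearMap.ker φ) + 1 = finrank F2 V := by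
    obtain ⟨v, hv⟩ : ∃ v, φ v ≠ 0 := by
      by_contra hc
      push Not at hc
      exact hφ (LinearMap.ext hc)
    have := finrank_inf_ker ⊤ φ v trivial ((f2_cases _).resolve_left hv)
    rwa [finrank_top, top_inf_eq] at this
  refine ⟨LinearMap.ker φ, m, hW, ⟨?_, ?_, ?_⟩, ?_⟩
  · intro T hT
    obtain ⟨a, b⟩ := hm2 T hT
    exact ⟨a, by omega⟩
  · intro x hx
    rw [hm3]
    exact h.cov _ (by simpa using hx)
  · rw [hm3]
    exact h.zero
  · omega

lemma main_bound (k d : ℕ) (j : ℕ) :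
    ∀ (V : Type) [AddCommGroup V] [Module F2 V] [FiniteDimensional F2 V]
    (H : Multiset (AffineSubspace F2 V)), IsCov k d H →
    finrank F2 V = Nat.log 2 k + d + 1 + j → 2 ^ d * k + j ≤ Multiset.card H := by
  induction j with
  | zero =>
    intro V _ _ _ H h hV
    have h1 := double_count h (by omega)
    have h2 : finrank F2 V - d = Nat.log 2 k + 1 := by omega
    have h3 : k < 2 ^ (Nat.log 2 k + 1) := Nat.lt_pow_succ_log_self (by norm_num) k
    have h4 : 2 ^ finrank F2 V = 2 ^ d * 2 ^ (Nat.log 2 k + 1) := by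
      rw [← pow_add]; congr 1; omega
    rw [h2, h4] at h1
    have h5 : (2 ^ d * k) * 2 ^ (Nat.log 2 k + 1)
        < (Multiset.card H + 1) * 2 ^ (Nat.log 2 k + 1) := by nlinarith
    have := lt_of_mul_lt_mul_right h5 (Nat.zero_le _)
    omega
  | succ j ih =>
    intro V _ _ _ H h hV
    obtain ⟨W, m, hW, hm, hc⟩ := descend h (by omega)
    have := ih W m hm (by omega)
    omega

lemma exists_cover (n k d : ℕ) (hk : 1 ≤ k) (hd : 1 ≤ d) (hdn : d ≤ n) :
    ∃ H, IsCover n k d H := by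
  have hfin : finrank F2 (Fin n → F2) = n := by simp
  have hex : ∀ x : Fin n → F2, ∃ S : AffineSubspace F2 (Fin n → F2), x ≠ 0 →
      (x ∈ S ∧ 0 ∉ S ∧ finrank F2 S.direction = n - d) := by
    intro x
    by_cases hx : x = 0
    · exact ⟨⊤, fun h => absurd hx h⟩
    · obtain ⟨D, hD, hDf⟩ := exists_subspace x hx d hd (by omega)
      refine ⟨AffineSubspace.mk' x D, fun _ => ⟨AffineSubspace.self_mem_mk' _ _, ?_, ?_⟩⟩
      · rw [AffineSubspace.mem_mk']
        simpa using hD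
      · rw [AffineSubspace.direction_mk', hDf, hfin]
  choose S hS using hex
  refine ⟨∑ x ∈ Finset.univ.erase (0 : Fin n → F2), Multiset.replicate k (S x), ?_, ?_, ?_⟩
  · intro T hT
    obtain ⟨x, hx, hT⟩ := Multiset.mem_sum.1 hT
    have := hS x (Finset.ne_of_mem_erase hx)
    rw [Multiset.eq_of_mem_replicate hT]
    exact ⟨⟨x, this.1⟩, this.2.2⟩
  · intro x hx
    unfold covCount
    have h1 : Multiset.replicate k (S x) ≤
        ∑ x ∈ Finset.univ.erase (0 : Fin n → F2), Multiset.replicate k (S x) :=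
      Finset.single_le_sum (f := fun x => Multiset.replicate k (S x))
        (fun _ _ => Multiset.zero_le _) (Finset.mem_erase.2 ⟨hx, Finset.mem_univ x⟩)
    have h2 := Multiset.countP_le_of_le (fun T => x ∈ T) h1
    refine le_trans (le_of_eq ?_) h2
    rw [Multiset.countP_eq_card.2, Multiset.card_replicate]
    intro T hT
    rw [Multiset.eq_of_mem_replicate hT]
    exact (hS x hx).1
  · unfold covCount
    rw [Multiset.countP_eq_zero.2]
    · omega
    · intro T hT
      obtain ⟨x, hx, hT⟩ := Multiset.mem_sum.1 hT
      rw [Multiset.eq_of_mem_replicate hT]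
      exact (hS x (Finset.ne_of_mem_erase hx)).2.1

end CoverProof

theorem stmt2 (n k d : ℕ) (hk : 2 ≤ k) (hd : 1 ≤ d) (hdn : d ≤ n)
    (hn : Nat.log 2 k + d + 1 ≤ n) :
    (n : ℝ) + 2 ^ d * k - d - Real.logb 2 (2 * k) ≤ (f n k d : ℝ) := by
  have hne : {m | ∃ H, IsCover n k d H ∧ Multiset.card H = m}.Nonempty := by
    obtain ⟨H, hH⟩ := CoverProof.exists_cover n k d (by omega) hd hdn
    exact ⟨_, H, hH, rfl⟩
  obtain ⟨H, hH, hc⟩ := Nat.sInf_mem hne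
  have hf : Multiset.card H = f n k d := hc
  have hfin : Module.finrank F2 (Fin n → F2) = n := by simp
  have hcov : CoverProof.IsCov k d H :=
    ⟨fun S hS => ⟨(hH.1 S hS).1, by rw [(hH.1 S hS).2, hfin]; omega⟩, hH.2.1, hH.2.2⟩
  obtain ⟨j, hj⟩ := Nat.exists_eq_add_of_le hn
  have hb := CoverProof.main_bound k d j _ H hcov (by rw [hfin, hj])
  rw [hf] at hb
  have hb' : (2 ^ d * k + j : ℝ) ≤ f n k d := by exact_mod_cast hb
  have hj' : (n : ℝ) = Nat.log 2 k + d + 1 + j := by exact_mod_cast hj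
  have hk0 : (0 : ℝ) < k := by exact_mod_cast (by omega : 0 < k)
  have hl : Real.logb 2 (2 * k) = 1 + Real.logb 2 k := by
    rw [Real.logb_mul (by norm_num) hk0.ne', Real.logb_self_eq_one (by norm_num)]
  have hl2 : (Nat.log 2 k : ℝ) ≤ Real.logb 2 k := by
    rw [Real.le_logb_iff_rpow_le (by norm_num) hk0, Real.rpow_natCast]
    exact_mod_cast Nat.pow_log_le_self 2 (by omega)
  linarith
end

section
/- Let n, k, d be integers with n ≥ d ≥ 2 and k ≥ 1. Then f(n,k,d) ≤ f(n−d+1,k,1) + 2k·(2^(d−1) − 1). -/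
open scoped Classical

lemma finrank_ker_proj_aux (m : ℕ) (i : Fin m) :
    Module.finrank F2 (LinearMap.ker (LinearMap.proj i : (Fin m → F2) →ₗ[F2] F2)) = m - 1 := by
  have h := LinearMap.finrank_range_add_finrank_ker (LinearMap.proj i : (Fin m → F2) →ₗ[F2] F2)
  have hr : LinearMap.range (LinearMap.proj i : (Fin m → F2) →ₗ[F2] F2) = ⊤ :=
    LinearMap.range_eq_top.2 (LinearMap.proj_surjective i)
  rw [hr, finrank_top, Module.finrank_self, Module.finrank_fin_fun] at h
  omega

lemma exists_cover_aux (m k : ℕ) (hk : 1 ≤ k) : ∃ H, IsCover m k 1 H := by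
  refine ⟨k • ((Finset.univ : Finset (Fin m)).val.map fun i =>
    AffineSubspace.mk' (Pi.single i 1 : Fin m → F2)
      (LinearMap.ker (LinearMap.proj i : (Fin m → F2) →ₗ[F2] F2))), ?_, ?_, ?_⟩
  · intro S hS
    have hS := Multiset.mem_of_mem_nsmul hS
    obtain ⟨i, -, rfl⟩ := Multiset.mem_map.1 hS
    refine ⟨⟨_, AffineSubspace.self_mem_mk' _ _⟩, ?_⟩
    rw [AffineSubspace.direction_mk', finrank_ker_proj_aux]
  · intro x hx
    obtain ⟨i, hi⟩ := Function.ne_iff.1 hx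
    have hi1 : x i = 1 := by
      have : ∀ a : ZMod 2, a ≠ 0 → a = 1 := by decide
      exact this _ hi
    unfold covCount
    rw [Multiset.countP_nsmul]
    refine Nat.le_mul_of_pos_right k (Multiset.countP_pos.2
      ⟨_, Multiset.mem_map.2 ⟨i, Finset.mem_univ i, rfl⟩, ?_⟩)
    rw [AffineSubspace.mem_mk']
    simp [hi1]
  · unfold covCount
    rw [Multiset.countP_nsmul]
    have : Multiset.countP (fun S => (0 : Fin m → F2) ∈ S)
      ((Finset.univ : Finset (Fin m)).val.map fun i =>
        AffineSubspace.mk' (Pi.single i 1 : Fin m → F2)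
          (LinearMap.ker (LinearMap.proj i : (Fin m → F2) →ₗ[F2] F2))) = 0 := by
      rw [Multiset.countP_eq_zero]
      intro S hS
      obtain ⟨i, -, rfl⟩ := Multiset.mem_map.1 hS
      rw [AffineSubspace.mem_mk']
      simp
    rw [this]
    omega

theorem stmt5 (n k d : ℕ) (hk : 1 ≤ k) (hd : 2 ≤ d) (hdn : d ≤ n) :
    f n k d ≤ f (n - d + 1) k 1 + 2 * k * (2 ^ (d - 1) - 1) := by
  obtain ⟨m, hm⟩ : ∃ m, m = n - d + 1 := ⟨_, rfl⟩
  rw [← hm]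
  have hmpos : 0 < m := by omega
  obtain ⟨H, hH, hcard⟩ : ∃ H, IsCover m k 1 H ∧ Multiset.card H = f m k 1 := by
    obtain ⟨H, hH⟩ := exists_cover_aux m k hk
    exact Nat.sInf_mem (s := {c | ∃ H, IsCover m k 1 H ∧ Multiset.card H = c}) ⟨_, H, hH, rfl⟩
  have e : ((Fin (d - 1) → F2) × (Fin m → F2)) ≃ₗ[F2] (Fin n → F2) := by
    apply LinearEquiv.ofFinrankEq
    rw [Module.finrank_prod, Module.finrank_fin_fun, Module.finrank_fin_fun,
      Module.finrank_fin_fun]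
    omega
  let φ : (Fin m → F2) →ₗ[F2] (Fin n → F2) :=
    e.toLinearMap ∘ₗ LinearMap.inr F2 (Fin (d - 1) → F2) (Fin m → F2)
  have hφ : ∀ w, φ w = e (0, w) := fun w => rfl
  have hinj : Function.Injective φ := by
    intro a b hab
    rw [hφ, hφ] at hab
    exact (Prod.ext_iff.1 (e.injective hab)).2
  have hfr : ∀ U : Submodule F2 (Fin m → F2), Module.finrank F2 (U.map φ) = Module.finrank F2 U :=
    fun U => (LinearEquiv.finrank_eq (Submodule.equivMapOfInjective φ hinj U)).symm
  let i0 : Fin m := ⟨0, hmpos⟩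
  let K : Submodule F2 (Fin m → F2) := LinearMap.ker (LinearMap.proj i0)
  have hK : Module.finrank F2 K = m - 1 := finrank_ker_proj_aux m i0
  let A : (Fin (d - 1) → F2) × F2 → AffineSubspace F2 (Fin n → F2) := fun p =>
    AffineSubspace.mk' (e (p.1, Pi.single i0 p.2)) (K.map φ)
  have hA : ∀ p v w, e (v, w) ∈ A p ↔ v = p.1 ∧ w i0 = p.2 := by
    intro p v w
    simp only [A, AffineSubspace.mem_mk', vsub_eq_sub, ← map_sub, Submodule.mem_map, hφ]
    constructor
    · rintro ⟨y, hy, h⟩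
      have h := e.injective h
      have hy : y i0 = 0 := hy
      simp only [Prod.mk_sub_mk, Prod.mk.injEq] at h
      obtain ⟨h1, h2⟩ := h
      refine ⟨(sub_eq_zero.1 h1.symm), ?_⟩
      have := congrFun h2 i0
      rw [hy] at this
      simp at this
      exact sub_eq_zero.1 this.symm
    · rintro ⟨h1, h2⟩
      refine ⟨w - Pi.single i0 p.2, ?_, ?_⟩
      · change (w - Pi.single i0 p.2 : Fin m → F2) i0 = 0
        simp [h2]
      · simp [h1]
  let I : Finset ((Fin (d - 1) → F2) × F2) := (Finset.univ.erase 0) ×ˢ Finset.univ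
  have hmem : ∀ w S, φ w ∈ AffineSubspace.map φ.toAffineMap S ↔ w ∈ S := fun w S =>
    AffineSubspace.mem_map_iff_mem_of_injective (f := φ.toAffineMap) hinj
  have hcount1 : ∀ w, covCount n (H.map (AffineSubspace.map φ.toAffineMap)) (φ w)
      = covCount m H w := by
    intro w
    unfold covCount
    rw [Multiset.countP_map, Multiset.countP_eq_card_filter]
    simp only [hmem]
  refine le_trans (Nat.sInf_le (m := Multiset.card
    (H.map (AffineSubspace.map φ.toAffineMap) + k • I.val.map A)) ⟨_, ⟨?_, ?_, ?_⟩, rfl⟩) ?_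
  · intro S hS
    rcases Multiset.mem_add.1 hS with hS | hS
    · obtain ⟨T, hT, rfl⟩ := Multiset.mem_map.1 hS
      obtain ⟨⟨x, hx⟩, hr⟩ := hH.1 T hT
      refine ⟨⟨φ x, (hmem x T).2 hx⟩, ?_⟩
      rw [AffineSubspace.map_direction, LinearMap.toAffineMap_linear,
        hfr, hr]
      omega
    · obtain ⟨p, -, rfl⟩ := Multiset.mem_map.1 (Multiset.mem_of_mem_nsmul hS)
      refine ⟨⟨_, AffineSubspace.self_mem_mk' _ _⟩, ?_⟩
      rw [AffineSubspace.direction_mk', hfr, hK]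
      omega
  · intro x hx
    obtain ⟨⟨v, w⟩, rfl⟩ := e.surjective x
    have hadd : ∀ (P Q : Multiset (AffineSubspace F2 (Fin n → F2))) y,
      covCount n (P + Q) y = covCount n P y + covCount n Q y := fun P Q y =>
        Multiset.countP_add _ _ _
    rw [hadd]
    by_cases hv : v = 0
    · subst hv
      have hw : w ≠ 0 := by
        rintro rfl
        exact hx (map_zero e)
      refine le_trans (hH.2.1 w hw) (le_trans (hcount1 w).ge (Nat.le_add_right _ _))
    · refine le_trans ?_ (Nat.le_add_left _ _)
      unfold covCount
      rw [Multiset.countP_nsmul]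
      refine Nat.le_mul_of_pos_right k (Multiset.countP_pos.2
        ⟨_, Multiset.mem_map.2 ⟨(v, w i0), ?_, rfl⟩, (hA _ _ _).2 ⟨rfl, rfl⟩⟩)
      change (v, w i0) ∈ I
      simp [I, hv]
  · have h0 := hcount1 0
    rw [map_zero] at h0
    unfold covCount at h0 ⊢
    rw [Multiset.countP_add, h0, Multiset.countP_nsmul]
    have : Multiset.countP (fun S => (0 : Fin n → F2) ∈ S) (I.val.map A) = 0 := by
      rw [Multiset.countP_eq_zero]
      intro S hS
      obtain ⟨p, hp, rfl⟩ := Multiset.mem_map.1 hS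
      have hp : p ∈ I := hp
      intro h
      have h' : e (0, 0) ∈ A p := by
        have : e (0, 0) = 0 := map_zero e
        rw [this]; exact h
      have := ((hA _ _ _).1 h').1
      simp only [I, Finset.mem_product, Finset.mem_erase] at hp
      exact hp.1.1 this.symm
    rw [this]
    rw [mul_zero, add_zero]
    exact hH.2.2
  · have hI : I.card = (2 ^ (d - 1) - 1) * 2 := by
      simp only [I, Finset.card_product]
      rw [Finset.card_erase_of_mem (Finset.mem_univ _), Finset.card_univ, Finset.card_univ]
      simp [ZMod.card]
    rw [Multiset.card_add, Multiset.card_map, hcard, Multiset.card_nsmul, Multiset.card_map,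
      Finset.card_val, hI]
    apply le_of_eq
    ring
end

section
/- Let n, k, d, s be integers with n ≥ 2, n > d ≥ 1, and k > s ≥ 0. Then g(n,k,d;s) ≥ g(n−1,k,d;s) + 1. -/
open scoped Classical

theorem aux_finrank_map {V W : Type*} [AddCommGroup V] [Module F2 V] [AddCommGroup W] [Module F2 W]
    {φ : V →ₗ[F2] W} (h : Function.Injective φ) (U : Submodule F2 V) :
    Module.finrank F2 (U.map φ) = Module.finrank F2 U :=
  (LinearEquiv.finrank_eq (Submodule.equivMapOfInjective φ h U)).symm

theorem aux_dbl (n m : ℕ) (H : Multiset (AffineSubspace F2 (Fin n → F2)))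
    (h : ∀ S ∈ H, (S : Set (Fin n → F2)).Nonempty ∧ Module.finrank F2 S.direction = m) :
    ∑ x, covCount n H x = Multiset.card H * 2 ^ m := by
  induction H using Multiset.induction_on with
  | empty => simp [covCount]
  | cons S H ih =>
    have ih' := ih (fun T hT => h T (Multiset.mem_cons_of_mem hT))
    obtain ⟨⟨p, hp⟩, hf⟩ := h S (Multiset.mem_cons_self S H)
    have hc : ∀ x, covCount n (S ::ₘ H) x = covCount n H x + if x ∈ S then 1 else 0 := by
      intro x
      simp only [covCount, Multiset.countP_cons]
    simp only [hc, Finset.sum_add_distrib, ih', Multiset.card_cons, add_mul, one_mul]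
    congr 1
    rw [Finset.sum_boole, ← hf]
    have h1 : Fintype.card S.direction = 2 ^ Module.finrank F2 S.direction := by
      rw [Module.card_eq_pow_finrank (K := F2)]
      simp [F2, ZMod.card]
    rw [← h1, Nat.cast_id, ← Fintype.card_subtype]
    refine Fintype.card_congr
      { toFun := fun x => ⟨x.1 - p, AffineSubspace.vsub_mem_direction x.2 hp⟩
        invFun := fun v => ⟨v.1 + p, AffineSubspace.vadd_mem_of_mem_direction v.2 hp⟩
        left_inv := fun x => by simp
        right_inv := fun v => by simp }

theorem aux_sub {n : ℕ} (W : Submodule F2 (Fin n → F2)) (m : ℕ) (h : m ≤ Module.finrank F2 W) :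
    ∃ U ≤ W, Module.finrank F2 U = m := by
  obtain ⟨t, ht, hli⟩ := exists_finset_linearIndependent_of_le_finrank h
  refine ⟨(Submodule.span F2 (t : Set W)).map W.subtype, Submodule.map_subtype_le _ _, ?_⟩
  rw [aux_finrank_map (Submodule.injective_subtype W),
    finrank_span_finset_eq_card hli, ht]

theorem aux_ker (n : ℕ) (x : Fin n → F2) (hx : x ≠ 0) :
    2 * (Finset.univ.filter (fun u : Fin n → F2 => u ⬝ᵥ x = 0)).card = 2 ^ n := by
  obtain ⟨i, hi⟩ : ∃ i, x i ≠ 0 := by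
    by_contra hcon
    push Not at hcon
    exact hx (funext hcon)
  have h2 : ∀ a : F2, a ≠ 0 ↔ a + 1 = 0 := by decide
  have hi1 : x i = 1 := by
    revert hi; generalize x i = a; revert a; decide
  have key : (Finset.univ.filter (fun u : Fin n → F2 => u ⬝ᵥ x = 0)).card
      = (Finset.univ.filter (fun u : Fin n → F2 => ¬ u ⬝ᵥ x = 0)).card := by
    refine Finset.card_equiv (Equiv.addRight (Pi.single i 1)) ?_
    intro u
    simp only [Finset.mem_filter, Finset.mem_univ, true_and, Equiv.coe_addRight, add_dotProduct,
      single_dotProduct, hi1, mul_one]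
    generalize u ⬝ᵥ x = a; revert a; decide
  have := Finset.card_filter_add_card_filter_not (s := (Finset.univ : Finset (Fin n → F2)))
    (fun u : Fin n → F2 => u ⬝ᵥ x = 0)
  rw [← key] at this
  rw [two_mul, this]
  simp [F2, ZMod.card]

theorem aux_split {n : ℕ} (P : AffineSubspace F2 (Fin n → F2)) (m : ℕ)
    (h : (P : Set (Fin n → F2)).Nonempty → m ≤ Module.finrank F2 P.direction) :
    ∃ T : Multiset (AffineSubspace F2 (Fin n → F2)),
      (∀ S ∈ T, (S : Set (Fin n → F2)).Nonempty ∧ Module.finrank F2 S.direction = m) ∧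
      ∀ y, covCount n T y = if y ∈ P then 1 else 0 := by
  by_cases hP : (P : Set (Fin n → F2)).Nonempty
  · obtain ⟨U, hU, hUm⟩ := aux_sub P.direction m (h hP)
    refine ⟨((Finset.univ.filter (· ∈ P)).image (fun y => AffineSubspace.mk' y U)).val, ?_, ?_⟩
    · intro S hS
      simp only [Finset.mem_val, Finset.mem_image, Finset.mem_filter, Finset.mem_univ, true_and] at hS
      obtain ⟨y, hy, rfl⟩ := hS
      exact ⟨⟨y, AffineSubspace.self_mem_mk' _ _⟩, by rw [AffineSubspace.direction_mk', hUm]⟩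
    · intro y
      rw [covCount, Multiset.countP_eq_card_filter, ← Finset.filter_val, Finset.card_val]
      split_ifs with hy
      · rw [Finset.card_eq_one]
        refine ⟨AffineSubspace.mk' y U, ?_⟩
        ext Q
        simp only [Finset.mem_filter, Finset.mem_image, Finset.mem_univ, true_and,
          Finset.mem_singleton]
        constructor
        · rintro ⟨⟨z, hz, rfl⟩, hyQ⟩
          have := AffineSubspace.mk'_eq hyQ
          rw [AffineSubspace.direction_mk'] at this
          exact this.symm
        · rintro rfl
          exact ⟨⟨y, hy, rfl⟩, AffineSubspace.self_mem_mk' _ _⟩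
      · rw [Finset.card_eq_zero, Finset.filter_eq_empty_iff]
        intro Q hQ hyQ
        simp only [Finset.mem_image, Finset.mem_filter, Finset.mem_univ, true_and] at hQ
        obtain ⟨z, hz, rfl⟩ := hQ
        rw [AffineSubspace.mem_mk'] at hyQ
        apply hy
        have := AffineSubspace.vadd_mem_of_mem_direction (hU hyQ) hz
        simpa using this
  · refine ⟨0, by simp, fun y => ?_⟩
    rw [if_neg (fun hy : y ∈ P => hP ⟨y, hy⟩)]
    simp [covCount]

theorem aux_choose (n : ℕ) (w : (Fin n → F2) → ℕ) (hw : ∀ x, x ≠ 0 → w 0 < w x) (hn : 1 ≤ n) :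
    ∃ u : Fin n → F2, u ≠ 0 ∧
      2 * ∑ x ∈ Finset.univ.filter (fun x => u ⬝ᵥ x = 0), w x < ∑ x, w x := by
  by_contra hcon
  push Not at hcon
  have hcard : (Finset.univ : Finset (Fin n → F2)).card = 2 ^ n := by simp [F2, ZMod.card]
  have hpos : 2 ≤ 2 ^ n := by
    calc 2 = 2 ^ 1 := rfl
      _ ≤ 2 ^ n := Nat.pow_le_pow_right (by norm_num) hn
  set A := ∑ x, w x with hA
  have h1 : ∑ u : Fin n → F2, (2 * ∑ x ∈ Finset.univ.filter (fun x => u ⬝ᵥ x = 0), w x)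
      = 2 ^ n * A + 2 ^ n * w 0 := by
    rw [← Finset.mul_sum]
    simp only [Finset.sum_filter]
    rw [Finset.sum_comm, Finset.mul_sum]
    have : ∀ x : Fin n → F2, 2 * ∑ u : Fin n → F2, (if u ⬝ᵥ x = 0 then w x else 0)
        = 2 ^ n * w x + if x = 0 then 2 ^ n * w 0 else 0 := by
      intro x
      rw [← Finset.sum_filter, Finset.sum_const, smul_eq_mul, ← mul_assoc]
      by_cases hx : x = 0
      · subst hx
        simp only [dotProduct_zero, Finset.filter_true, hcard, if_true]
        ring
      · rw [aux_ker n x hx, if_neg hx, add_zero]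
    rw [Finset.sum_congr rfl (fun x _ => this x), Finset.sum_add_distrib, ← Finset.mul_sum]
    simp [hA]
  have h2 : ∑ u : Fin n → F2, (A + if u = 0 then A else 0) ≤
      ∑ u : Fin n → F2, (2 * ∑ x ∈ Finset.univ.filter (fun x => u ⬝ᵥ x = 0), w x) := by
    refine Finset.sum_le_sum fun u _ => ?_
    by_cases hu : u = 0
    · subst hu
      simp [hA, two_mul]
    · rw [if_neg hu, add_zero]
      exact hcon u hu
  rw [h1, Finset.sum_add_distrib, Finset.sum_const, hcard] at h2
  simp only [Finset.sum_ite_eq', Finset.mem_univ, if_true, smul_eq_mul] at h2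
  have h3 : A ≤ 2 ^ n * w 0 := by omega
  have h4 : 2 ^ n * w 0 < A := by
    rw [← hcard, ← smul_eq_mul, ← Finset.sum_const]
    refine Finset.sum_lt_sum (fun x _ => ?_) ⟨fun _ => 1, Finset.mem_univ _, hw _ ?_⟩
    · by_cases hx : x = 0
      · rw [hx]
      · exact (hw x hx).le
    · intro h
      exact one_ne_zero (congrFun h ⟨0, hn⟩)
  omega

theorem aux_emb (N : ℕ) (u : Fin (N + 1) → F2) (hu : u ≠ 0) :
    ∃ e : (Fin N → F2) →ₗ[F2] (Fin (N + 1) → F2), Function.Injective e ∧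
      ∀ x, x ∈ LinearMap.range e ↔ u ⬝ᵥ x = 0 := by
  let φ : Module.Dual F2 (Fin (N + 1) → F2) := dotProductBilin F2 F2 u
  have hφ : φ ≠ 0 := by
    intro h
    apply hu
    funext i
    have := LinearMap.congr_fun h (Pi.single i 1)
    simpa [φ] using this
  have h1 := Module.Dual.finrank_ker_add_one_of_ne_zero hφ
  have h2 : Module.finrank F2 (Fin N → F2) = Module.finrank F2 (LinearMap.ker φ) := by
    simp at h1 ⊢
    omega
  let E := LinearEquiv.ofFinrankEq _ _ h2
  refine ⟨(LinearMap.ker φ).subtype ∘ₗ E.toLinearMap, ?_, ?_⟩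
  · simpa using E.injective
  · intro x
    rw [LinearMap.range_comp, LinearEquiv.range, Submodule.map_top, Submodule.range_subtype]
    rfl

theorem aux_restrict (N m : ℕ) (e : (Fin N → F2) →ₗ[F2] (Fin (N + 1) → F2))
    (he : Function.Injective e) (S : AffineSubspace F2 (Fin (N + 1) → F2))
    (hS : Module.finrank F2 S.direction = m + 1) :
    ∃ T : Multiset (AffineSubspace F2 (Fin N → F2)),
      (∀ S ∈ T, (S : Set (Fin N → F2)).Nonempty ∧ Module.finrank F2 S.direction = m) ∧
      ∀ y, covCount N T y = if e y ∈ S then 1 else 0 := by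
  obtain ⟨T, h1, h2⟩ := aux_split (S.comap e.toAffineMap) m (by
    rintro ⟨y, hy⟩
    have hd : (S.comap e.toAffineMap).direction = S.direction.comap e := by
      ext v
      rw [← AffineSubspace.vadd_mem_iff_mem_direction v hy, Submodule.mem_comap]
      have hy' : e y ∈ S := hy
      rw [← AffineSubspace.vadd_mem_iff_mem_direction (e v) hy']
      simp [AffineSubspace.mem_comap]
    rw [hd]
    have h3 : Module.finrank F2 (S.direction.comap e) =
        Module.finrank F2 (LinearMap.range e ⊓ S.direction : Submodule F2 _) := by
      rw [← Submodule.map_comap_eq]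
      exact (aux_finrank_map he _).symm
    have h4 := Submodule.finrank_sup_add_finrank_inf_eq (LinearMap.range e) S.direction
    have h5 := Submodule.finrank_le (LinearMap.range e ⊔ S.direction)
    have h6 := LinearMap.finrank_range_of_inj he
    simp at h5 h6
    omega)
  exact ⟨T, h1, fun y => h2 y⟩

theorem aux_restrict_all (N m : ℕ) (e : (Fin N → F2) →ₗ[F2] (Fin (N + 1) → F2))
    (he : Function.Injective e) (H : Multiset (AffineSubspace F2 (Fin (N + 1) → F2)))
    (hH : ∀ S ∈ H, Module.finrank F2 S.direction = m + 1) :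
    ∃ T : Multiset (AffineSubspace F2 (Fin N → F2)),
      (∀ S ∈ T, (S : Set (Fin N → F2)).Nonempty ∧ Module.finrank F2 S.direction = m) ∧
      ∀ y, covCount N T y = covCount (N + 1) H (e y) := by
  induction H using Multiset.induction_on with
  | empty => exact ⟨0, by simp, by simp [covCount]⟩
  | cons S H ih =>
    obtain ⟨T, h1, h2⟩ := ih (fun T hT => hH T (Multiset.mem_cons_of_mem hT))
    obtain ⟨T', h1', h2'⟩ := aux_restrict N m e he S (hH S (Multiset.mem_cons_self S H))
    refine ⟨T + T', ?_, ?_⟩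
    · intro Q hQ
      rcases Multiset.mem_add.1 hQ with h | h
      · exact h1 Q h
      · exact h1' Q h
    · intro y
      have a := h2 y
      have b := h2' y
      simp only [covCount, Multiset.countP_cons, Multiset.countP_add] at a b ⊢
      rw [a, b]

theorem aux_exists (n k d s : ℕ) (hd : 1 ≤ d) (hdn : d < n) :
    ∃ H, IsCoverExact n k d s H := by
  have hx : ∀ x : Fin n → F2, ∃ S : AffineSubspace F2 (Fin n → F2),
      ((S : Set (Fin n → F2)).Nonempty ∧ Module.finrank F2 S.direction = n - d) ∧
      x ∈ S ∧ (x ≠ 0 → (0 : Fin n → F2) ∉ S) := by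
    intro x
    obtain ⟨C, hC⟩ := Submodule.exists_isCompl (Submodule.span F2 {x})
    have h1 := Submodule.finrank_add_eq_of_isCompl hC
    have h2 := finrank_span_le_card (R := F2) ({x} : Set (Fin n → F2))
    simp at h1 h2
    obtain ⟨U, hU, hUm⟩ := aux_sub C (n - d) (by omega)
    refine ⟨AffineSubspace.mk' x U, ⟨⟨x, AffineSubspace.self_mem_mk' _ _⟩, by
      rw [AffineSubspace.direction_mk', hUm]⟩, AffineSubspace.self_mem_mk' _ _, ?_⟩
    intro hx0 h0
    rw [AffineSubspace.mem_mk'] at h0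
    have h3 : x ∈ C := by
      have := C.neg_mem (hU h0)
      simpa using this
    exact hx0 ((Submodule.disjoint_def.1 hC.disjoint) x (Submodule.mem_span_singleton_self x) h3)
  choose S hS hS1 hS2 using hx
  refine ⟨Multiset.replicate s (S 0) +
    k • ((Finset.univ.filter (fun x : Fin n → F2 => x ≠ 0)).val.map S), ?_, ?_, ?_⟩
  · intro Q hQ
    rcases Multiset.mem_add.1 hQ with h | h
    · rw [Multiset.eq_of_mem_replicate h]
      exact hS 0
    · obtain ⟨x, -, rfl⟩ := Multiset.mem_map.1 (Multiset.mem_of_mem_nsmul h)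
      exact hS x
  · intro x hx
    rw [covCount, Multiset.countP_add, Multiset.countP_nsmul]
    have : 0 < Multiset.countP (fun Q => x ∈ Q)
        ((Finset.univ.filter (fun x : Fin n → F2 => x ≠ 0)).val.map S) := by
      rw [Multiset.countP_pos]
      exact ⟨S x, Multiset.mem_map.2 ⟨x, by simpa using hx, rfl⟩, hS1 x⟩
    have := Nat.le_mul_of_pos_right k this
    exact this.trans (Nat.le_add_left _ _)
  · rw [covCount, Multiset.countP_add, Multiset.countP_nsmul]
    have h1 : Multiset.countP (fun Q => (0 : Fin n → F2) ∈ Q)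
        ((Finset.univ.filter (fun x : Fin n → F2 => x ≠ 0)).val.map S) = 0 := by
      rw [Multiset.countP_eq_zero]
      intro Q hQ
      obtain ⟨x, hx, rfl⟩ := Multiset.mem_map.1 hQ
      exact hS2 x (by simpa using hx)
    have h2 : Multiset.countP (fun Q => (0 : Fin n → F2) ∈ Q) (Multiset.replicate s (S 0)) = s := by
      have := Multiset.countP_eq_card (p := fun Q => (0 : Fin n → F2) ∈ Q)
        (s := Multiset.replicate s (S 0))
      rw [this.2 (fun a ha => by rw [Multiset.eq_of_mem_replicate ha]; exact hS1 0)]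
      simp
    rw [h1, h2]
    simp

theorem stmt7 (n k d s : ℕ) (hn : 2 ≤ n) (hd : 1 ≤ d) (hdn : d < n) (hs : s < k) :
    g (n - 1) k d s + 1 ≤ g n k d s := by
  obtain ⟨N, rfl⟩ : ∃ N, n = N + 1 := ⟨n - 1, by omega⟩
  rw [Nat.add_sub_cancel]
  obtain ⟨H0, hH0⟩ := aux_exists (N + 1) k d s hd hdn
  obtain ⟨H, hH, hc⟩ := Nat.sInf_mem
    (s := {m | ∃ H, IsCoverExact (N + 1) k d s H ∧ Multiset.card H = m}) ⟨_, H0, hH0, rfl⟩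
  change Multiset.card H = g (N + 1) k d s at hc
  rw [← hc]
  obtain ⟨hH1, hH2, hH3⟩ := hH
  obtain ⟨u, hu, hlt⟩ := aux_choose (N + 1) (covCount (N + 1) H)
    (fun x hx => by rw [hH3]; exact lt_of_lt_of_le hs (hH2 x hx)) (by omega)
  obtain ⟨e, he, hr⟩ := aux_emb N u hu
  have hm : N + 1 - d = (N - d) + 1 := by omega
  obtain ⟨T, hT1, hT2⟩ := aux_restrict_all N (N - d) e he H
    (fun S hS => by rw [(hH1 S hS).2, hm])
  have hg : g N k d s ≤ Multiset.card T := by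
    refine Nat.sInf_le ⟨T, ⟨hT1, ?_, ?_⟩, rfl⟩
    · intro x hx
      rw [hT2]
      exact hH2 _ (fun h => hx (he (by rw [h, map_zero])))
    · rw [hT2, map_zero, hH3]
  have c1 := aux_dbl N (N - d) T hT1
  have c2 := aux_dbl (N + 1) (N - d + 1) H (fun S hS => by rw [← hm]; exact hH1 S hS)
  have c3 : ∑ y, covCount N T y =
      ∑ x ∈ Finset.univ.filter (fun x => u ⬝ᵥ x = 0), covCount (N + 1) H x := by
    refine Finset.sum_bij (fun y _ => e y) ?_ ?_ ?_ ?_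
    · intro y _
      simp only [Finset.mem_filter, Finset.mem_univ, true_and]
      exact (hr _).1 ⟨y, rfl⟩
    · intro a _ b _ h
      exact he h
    · intro x hx
      simp only [Finset.mem_filter, Finset.mem_univ, true_and] at hx
      obtain ⟨y, hy⟩ := (hr x).2 hx
      exact ⟨y, Finset.mem_univ _, hy⟩
    · intro y _
      exact hT2 y
  rw [← c3, c1, c2, pow_succ] at hlt
  have : Multiset.card T < Multiset.card H := by
    by_contra hcon
    push Not at hcon
    have := Nat.mul_le_mul_right (2 ^ (N - d)) hcon
    nlinarith
  omega
end

section
/- Let n, k, d be integers with n ≥ d ≥ 1, k ≥ 1, and n > 2^(2^d·k − k − d + 1). Then every (k,d)-cover of 𝔽₂ⁿ of cardinality f(n,k,d) (i.e., every optimal (k,d)-cover) contains the origin in at least k−2 of its members (counted with multiplicity). -/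
open scoped Classical

lemma f2_ne_zero (a : F2) (h : a ≠ 0) : a = 1 := by
  revert a; decide

/-- Hamming bound for codes with minimum distance at least three. -/
lemma hamming3 (n m : ℕ) (U : Fin m → ((Fin n → F2) →ₗ[F2] F2))
    (hU : ∀ x, x ≠ 0 → 3 ≤ (Finset.univ.filter (fun i => U i x ≠ 0)).card) :
    2 ^ n * (m + 1) ≤ 2 ^ m := by
  let e : Option (Fin m) → (Fin m → F2) := fun o i => if o = some i then 1 else 0
  have he : Function.Injective e := by
    intro o o' h
    cases o with
    | none =>
      cases o' with
      | none => rfl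
      | some j => have := congrFun h j; simp [e] at this
    | some i =>
      have := congrFun h i
      by_contra hne
      simp [e] at this
      exact hne this.symm
  let F : (Fin n → F2) × Option (Fin m) → (Fin m → F2) := fun p i => U i p.1 + e p.2 i
  have hF : Function.Injective F := by
    rintro ⟨x, o⟩ ⟨y, o'⟩ h
    have hxy : x = y := by
      by_contra hne
      have h3 := hU (x - y) (sub_ne_zero.mpr hne)
      have hsub : (Finset.univ.filter (fun i => U i (x - y) ≠ 0)) ⊆ o.toFinset ∪ o'.toFinset := by
        intro i hi
        simp only [Finset.mem_filter, Finset.mem_univ, true_and] at hi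
        simp only [Finset.mem_union, Option.mem_toFinset, Option.mem_def]
        by_contra hc
        push Not at hc
        have hi' := congrFun h i
        simp only [F, e, hc.1, hc.2, if_false, add_zero] at hi'
        exact hi (by rw [map_sub, hi', sub_self])
      have h4 := Finset.card_le_card hsub
      have h5 := Finset.card_union_le o.toFinset o'.toFinset
      have h6 : ∀ o : Option (Fin m), o.toFinset.card ≤ 1 := by
        intro o; cases o <;> simp
      have := h6 o
      have := h6 o'
      omega
    subst hxy
    have : e o = e o' := by
      funext i
      have := congrFun h i
      simpa [F] using this
    rw [he this]
  have := Fintype.card_le_of_injective F hF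
  simpa [Fintype.card_prod, Fintype.card_option, ZMod.card] using this

lemma exists_functional (n : ℕ) (S : AffineSubspace F2 (Fin n → F2))
    (hS : (S : Set (Fin n → F2)).Nonempty) (h0 : (0 : Fin n → F2) ∉ S) :
    ∃ u : (Fin n → F2) →ₗ[F2] F2, ∀ x ∈ S, u x ≠ 0 := by
  obtain ⟨p, hp⟩ := hS
  have hp' : p ∉ S.direction := by
    intro h
    apply h0
    have := AffineSubspace.vadd_mem_of_mem_direction (S.direction.neg_mem h) hp
    simpa using this
  obtain ⟨u, hu, hk⟩ := Submodule.exists_le_ker_of_notMem hp'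
  refine ⟨u, fun x hx => ?_⟩
  have h1 : x - p ∈ S.direction := AffineSubspace.vsub_mem_direction hx hp
  have h2 := hk h1
  rw [LinearMap.mem_ker, map_sub, sub_eq_zero] at h2
  rw [h2]; exact hu

lemma lower (n k d : ℕ) (H : Multiset (AffineSubspace F2 (Fin n → F2)))
    (hn : 1 ≤ n) (hH : IsCover n k d H) (hs : covCount n H 0 + 3 ≤ k) :
    ∃ m, Multiset.card H = m + (k - 3) ∧ 2 ^ n * (m + 1) ≤ 2 ^ m := by
  obtain ⟨h1, h2, -⟩ := hH
  set s := covCount n H 0 with hsdef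
  obtain ⟨l, hl⟩ := Quot.exists_rep (H.filter (fun S => (0 : Fin n → F2) ∉ S))
  replace hl : (l : Multiset _) = H.filter (fun S => (0 : Fin n → F2) ∉ S) := hl
  have hcard : Multiset.card H = s + l.length := by
    rw [← Multiset.coe_card, hl, ← Multiset.countP_eq_card_filter, hsdef, covCount]
    exact Multiset.card_eq_countP_add_countP _ H
  have hcov : ∀ x : Fin n → F2, x ≠ 0 → k ≤ s + l.countP (fun S => x ∈ S) := by
    intro x hx
    refine (h2 x hx).trans ?_
    rw [← Multiset.coe_countP, hl]
    unfold covCount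
    conv_lhs => rw [← Multiset.filter_add_not (fun S => (0 : Fin n → F2) ∈ S) H]
    rw [Multiset.countP_add]
    gcongr
    refine (Multiset.countP_le_card _ _).trans ?_
    rw [← Multiset.countP_eq_card_filter, hsdef, covCount]
  set t := k - s - 3 with ht
  have hlen : t ≤ l.length := by
    have := hcov (fun _ => 1) (by
      intro h; have := congrFun h ⟨0, hn⟩; simp at this)
    have h' := List.countP_le_length (p := fun S => decide ((fun _ => 1 : Fin n → F2) ∈ S)) (l := l)
    omega
  have hmem : ∀ S ∈ l, ∃ u : (Fin n → F2) →ₗ[F2] F2, ∀ x ∈ S, u x ≠ 0 := by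
    intro S hS
    have : S ∈ H.filter (fun S => (0 : Fin n → F2) ∉ S) := by rw [← hl]; exact hS
    rw [Multiset.mem_filter] at this
    exact exists_functional n S (h1 S this.1).1 this.2
  refine ⟨(l.drop t).length, ?_, ?_⟩
  · rw [List.length_drop]; omega
  · have hm' : ∀ i : Fin (l.drop t).length,
        ∃ u : (Fin n → F2) →ₗ[F2] F2, ∀ x ∈ (l.drop t).get i, u x ≠ 0 := fun i =>
      hmem _ (List.mem_of_mem_drop (List.get_mem _ _))
    choose U hU using hm'
    apply hamming3 n _ U
    intro x hx
    have h3 : 3 ≤ (l.drop t).countP (fun S => x ∈ S) := by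
      have ha := hcov x hx
      rw [← List.take_append_drop t l, List.countP_append] at ha
      have hb := List.countP_le_length (p := fun S => decide (x ∈ S)) (l := l.take t)
      rw [List.length_take] at hb
      omega
    have h4 : (l.drop t).countP (fun S => x ∈ S)
        = (Finset.univ.filter (fun i => x ∈ (l.drop t).get i)).card := by
      have : ((l.drop t : List _) : Multiset (AffineSubspace F2 (Fin n → F2)))
          = (Finset.univ : Finset (Fin (l.drop t).length)).val.map (l.drop t).get := by
        rw [Fin.univ_val_map, List.ofFn_get]
      rw [← Multiset.coe_countP, this, Multiset.countP_map]
      rfl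
    rw [h4] at h3
    refine h3.trans (Finset.card_le_card ?_)
    intro i
    simp only [Finset.mem_filter, Finset.mem_univ, true_and]
    exact hU i x

section construction

variable (n e : ℕ) (h : e ≤ n)

/-- projection to the first `e` coordinates together with a functional -/
noncomputable def phi (l : (Fin n → F2) →ₗ[F2] F2) :
    (Fin n → F2) →ₗ[F2] ((Fin e → F2) × F2) :=
  (LinearMap.funLeft F2 F2 (Fin.castLE h)).prod l

lemma phi_apply (l : (Fin n → F2) →ₗ[F2] F2) (x : Fin n → F2) :
    phi n e h l x = (x ∘ Fin.castLE h, l x) := rfl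

lemma phi_surj (l : (Fin n → F2) →ₗ[F2] F2) (j : Fin n) (hj : e ≤ j)
    (hl : l (Pi.single j 1) = 1) : Function.Surjective (phi n e h l) := by
  rintro ⟨a, b⟩
  let x0 : Fin n → F2 := fun i => if hi : (i : ℕ) < e then a ⟨i, hi⟩ else 0
  refine ⟨x0 + (b - l x0) • Pi.single j 1, ?_⟩
  rw [phi_apply, map_add, map_smul, hl]
  refine Prod.ext ?_ (by simp)
  funext i
  have hij : Fin.castLE h i ≠ j := by
    intro hc
    have := congrArg Fin.val hc
    have := i.2
    simp at *
    omega
  simp [x0, hij]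

/-- the affine subspace where `phi = w` -/
noncomputable def P (l : (Fin n → F2) →ₗ[F2] F2) (w : (Fin e → F2) × F2) :
    AffineSubspace F2 (Fin n → F2) :=
  AffineSubspace.mk' (Function.invFun (phi n e h l) w) (LinearMap.ker (phi n e h l))

/-- good functionals -/
def Good (l : (Fin n → F2) →ₗ[F2] F2) : Prop :=
  ∃ j : Fin n, e ≤ j ∧ l (Pi.single j 1) = 1

lemma mem_P (l : (Fin n → F2) →ₗ[F2] F2) (hl : Good n e l) (w : (Fin e → F2) × F2)
    (x : Fin n → F2) : x ∈ P n e h l w ↔ phi n e h l x = w := by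
  obtain ⟨j, hj, hl⟩ := hl
  have hsurj := phi_surj n e h l j hj hl
  rw [P, AffineSubspace.mem_mk', LinearMap.mem_ker, vsub_eq_sub, map_sub, sub_eq_zero,
    Function.invFun_eq (hsurj w)]

lemma P_good (l : (Fin n → F2) →ₗ[F2] F2) (hl : Good n e l) (w : (Fin e → F2) × F2) :
    (P n e h l w : Set (Fin n → F2)).Nonempty ∧
      Module.finrank F2 (P n e h l w).direction = n - (e + 1) := by
  obtain ⟨j, hj, hl⟩ := hl
  have hsurj := phi_surj n e h l j hj hl
  refine ⟨AffineSubspace.mk'_nonempty _ _, ?_⟩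
  rw [P, AffineSubspace.direction_mk']
  have h1 := LinearMap.finrank_range_add_finrank_ker (phi n e h l)
  rw [LinearMap.range_eq_top.mpr hsurj, finrank_top] at h1
  simp at h1
  omega

/-- coordinate functional -/
def co (i : Fin n) : (Fin n → F2) →ₗ[F2] F2 := LinearMap.proj i

/-- parity functional on the coordinates from `e` on -/
noncomputable def par : (Fin n → F2) →ₗ[F2] F2 :=
  ∑ i ∈ Finset.univ.filter (fun i : Fin n => e ≤ i), LinearMap.proj i

lemma par_apply (x : Fin n → F2) :
    par n e x = ∑ i ∈ Finset.univ.filter (fun i : Fin n => e ≤ i), x i := by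
  simp [par]

lemma good_co (i : Fin n) (hi : e ≤ i) : Good n e (co n i) := ⟨i, hi, by simp [co]⟩

lemma good_par (h' : e < n) : Good n e (par n e) :=
  ⟨⟨e, h'⟩, le_rfl, by
    rw [par_apply, Finset.sum_eq_single ⟨e, h'⟩]
    · simp
    · intro b _ hb; simp [hb]
    · intro hc; simp at hc⟩

/-- multiplicities -/
noncomputable def mu (k : ℕ) (a : Fin e → F2) : ℕ := if a = 0 then k - 2 else k

/-- the extremal cover -/
noncomputable def Hc (k : ℕ) : Multiset (AffineSubspace F2 (Fin n → F2)) :=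
  (∑ w : (Fin e → F2) × F2, Multiset.replicate (mu e k w.1)
    (P n e h (par n e) w)) +
  (∑ i ∈ Finset.univ.filter (fun i : Fin n => e ≤ i), {P n e h (co n i) (0, 1)}) +
  {P n e h (par n e) (0, 1)}

lemma card_Hc (k : ℕ) (hk : 2 ≤ k) (h' : e < n) :
    Multiset.card (Hc n e h k) + (e + 1) + 2 = n + 2 ^ (e + 1) * k := by
  have hfil : (Finset.univ.filter (fun i : Fin n => e ≤ i)).card = n - e := by
    have : Finset.univ.filter (fun i : Fin n => e ≤ i) = Finset.Ici (⟨e, h'⟩ : Fin n) := by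
      ext i; simp [Fin.le_def]
    rw [this, Fin.card_Ici]
  have hsum : (∑ w : (Fin e → F2) × F2, mu e k w.1) + 4
      = 2 ^ (e + 1) * k := by
    rw [Fintype.sum_prod_type]
    simp only [Finset.sum_const, Finset.card_univ, ZMod.card, smul_eq_mul]
    rw [← Finset.add_sum_erase _ _ (Finset.mem_univ (0 : Fin e → F2))]
    rw [Finset.sum_congr rfl (g := fun _ => 2 * k)
      (by intro x hx; rw [mu, if_neg (Finset.ne_of_mem_erase hx)])]
    rw [Finset.sum_const, Finset.card_erase_of_mem (Finset.mem_univ _), Finset.card_univ]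
    simp only [Fintype.card_fun, ZMod.card, Fintype.card_fin, mu, if_true, smul_eq_mul]
    have : 1 ≤ 2 ^ e := Nat.one_le_two_pow
    obtain ⟨q, hq⟩ := Nat.exists_eq_add_of_le this
    obtain ⟨r, rfl⟩ := Nat.exists_eq_add_of_le hk
    rw [pow_succ, hq]
    simp only [Nat.add_sub_cancel_left]
    ring
  simp only [Hc, Multiset.card_add, Multiset.card_sum, Multiset.card_replicate,
    Multiset.card_singleton, Finset.sum_const, hfil, smul_eq_mul]
  omega

lemma cov_Hc (k : ℕ) (h' : e < n) (x : Fin n → F2) :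
    covCount n (Hc n e h k) x = mu e k (x ∘ Fin.castLE h) +
      (∑ i ∈ Finset.univ.filter (fun i : Fin n => e ≤ i),
        if x ∘ Fin.castLE h = 0 ∧ x i = 1 then 1 else 0) +
      (if x ∘ Fin.castLE h = 0 ∧ par n e x = 1 then 1 else 0) := by
  have hs : ∀ {ι : Type} (s : Finset ι) (F : ι → Multiset (AffineSubspace F2 (Fin n → F2))),
      Multiset.countP (fun S => x ∈ S) (∑ i ∈ s, F i)
        = ∑ i ∈ s, Multiset.countP (fun S => x ∈ S) (F i) := fun s F =>
    map_sum (Multiset.countPAddMonoidHom (fun S => x ∈ S)) F s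
  have hsing : ∀ S : AffineSubspace F2 (Fin n → F2),
      Multiset.countP (fun S => x ∈ S) {S} = if x ∈ S then 1 else 0 := by
    intro S
    rw [← Multiset.cons_zero, Multiset.countP_cons]; simp
  have hrep : ∀ (m : ℕ) (S : AffineSubspace F2 (Fin n → F2)),
      Multiset.countP (fun S => x ∈ S) (Multiset.replicate m S) = if x ∈ S then m else 0 := by
    intro m S
    rw [← Multiset.coe_replicate, Multiset.coe_countP, List.countP_replicate]; simp
  rw [covCount, Hc, Multiset.countP_add, Multiset.countP_add, hs, hs, hsing]
  congr 1
  · congr 1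
    · simp only [hrep, mem_P n e h _ (good_par n e h')]
      rw [Finset.sum_ite_eq]
      simp [phi_apply]
    · apply Finset.sum_congr rfl
      intro i hi
      rw [hsing]
      simp only [mem_P n e h _ (good_co n e i (Finset.mem_filter.mp hi).2), phi_apply,
        Prod.mk.injEq]
      rfl
  · simp only [mem_P n e h _ (good_par n e h'), phi_apply, Prod.mk.injEq]

lemma cover_Hc (k : ℕ) (hk : 2 ≤ k) (h' : e < n) : IsCover n k (e + 1) (Hc n e h k) := by
  refine ⟨?_, ?_, ?_⟩
  · intro S hS
    simp only [Hc, Multiset.mem_add, Multiset.mem_sum, Multiset.mem_singleton] at hS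
    rcases hS with (⟨w, -, hS⟩ | ⟨i, hi, hS⟩) | hS
    · rw [Multiset.eq_of_mem_replicate hS]
      exact P_good n e h _ (good_par n e h') w
    · rw [hS]
      exact P_good n e h _ (good_co n e i (Finset.mem_filter.mp hi).2) _
    · rw [hS]
      exact P_good n e h _ (good_par n e h') _
  · intro x hx
    rw [cov_Hc n e h k h']
    by_cases hx0 : x ∘ Fin.castLE h = 0
    swap
    · rw [mu, if_neg hx0]; omega
    simp only [hx0, true_and, mu, if_true]
    have hj : ∃ j : Fin n, e ≤ j ∧ x j = 1 := by
      by_contra hc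
      push Not at hc
      apply hx
      funext j
      by_cases hje : e ≤ j
      · by_contra hne
        exact hc j hje (f2_ne_zero _ hne)
      · exact congrFun hx0 ⟨j, by omega⟩
    obtain ⟨j, hje, hj⟩ := hj
    rw [← Finset.card_filter]
    set T := (Finset.univ.filter (fun i : Fin n => e ≤ i)).filter (fun i => x i = 1) with hT
    have hjT : j ∈ T := by simp [hT, hje, hj]
    have hpar : par n e x = (T.card : F2) := by
      rw [par_apply, hT, Finset.card_filter, Nat.cast_sum]
      apply Finset.sum_congr rfl
      intro i _
      by_cases hi : x i = 1
      · simp [hi]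
      · have : x i = 0 := by
          by_contra hne
          exact hi (f2_ne_zero _ hne)
        simp [this]
    have hpos : 1 ≤ T.card := Finset.card_pos.mpr ⟨j, hjT⟩
    rcases Nat.eq_or_lt_of_le hpos with h1 | h1
    · rw [hpar, ← h1]; simp; omega
    · omega
  · rw [cov_Hc n e h k h']
    have : (0 : Fin n → F2) ∘ Fin.castLE h = 0 := rfl
    simp [this, mu]
    omega

end construction

theorem stmt11 (n k d : ℕ) (hk : 1 ≤ k) (hd : 1 ≤ d) (hdn : d ≤ n)
    (hbig : 2 ^ (2 ^ d * k - k - d + 1) < n) :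
    ∀ H, IsCover n k d H → Multiset.card H = f n k d → k - 2 ≤ covCount n H 0 := by
  intro H hH hcard
  by_contra hlt
  push Not at hlt
  obtain ⟨m, hm, hham⟩ := lower n k d H (by omega) hH (by omega)
  obtain ⟨e, rfl⟩ := Nat.exists_eq_add_of_le' hd
  have hup : f n k (e + 1) ≤ Multiset.card (Hc n e (by omega) k) :=
    Nat.sInf_le ⟨_, cover_Hc n e (by omega) k (by omega) (by omega), rfl⟩
  have hc := card_Hc n e (by omega) k (by omega) (by omega)
  have hnm : n ≤ m := by
    have : 2 ^ n ≤ 2 ^ m := le_trans (Nat.le_mul_of_pos_right _ (by omega)) hham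
    exact (Nat.pow_le_pow_iff_right (by norm_num)).mp this
  have h2 : 2 ^ (n + (2 ^ (e + 1) * k - k - (e + 1) + 1)) < 2 ^ m := by
    rw [pow_add]
    refine lt_of_lt_of_le ?_ hham
    exact Nat.mul_lt_mul_of_pos_left (by omega) (by positivity)
  have h3 := (Nat.pow_lt_pow_iff_right (by norm_num)).mp h2
  omega
end

section
/- Let n ≥ 1 and k ≥ 2 be integers. Then f(n,k−1,1) + 1 ≤ f(n,k,1) ≤ f(n,k−1,1) + 2. -/
open scoped Classical

theorem f2_cases : ∀ c : F2, c = 0 ∨ c = 1 := by decide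

/-- The hyperplane `x i = c`. -/
noncomputable def hyp (n : ℕ) (i : Fin n) (c : F2) : AffineSubspace F2 (Fin n → F2) :=
  AffineSubspace.mk' (Pi.single i c) (LinearMap.ker (LinearMap.proj i : (Fin n → F2) →ₗ[F2] F2))

theorem mem_hyp (n : ℕ) (i : Fin n) (c : F2) (x : Fin n → F2) : x ∈ hyp n i c ↔ x i = c := by
  simp [hyp, AffineSubspace.mem_mk', sub_eq_zero]

theorem hyp_ok (n : ℕ) (i : Fin n) (c : F2) :
    (hyp n i c : Set (Fin n → F2)).Nonempty ∧ Module.finrank F2 (hyp n i c).direction = n - 1 := by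
  refine ⟨⟨Pi.single i c, by simp [mem_hyp]⟩, ?_⟩
  have h := LinearMap.finrank_range_add_finrank_ker
    (LinearMap.proj i : (Fin n → F2) →ₗ[F2] F2)
  have hs : LinearMap.range (LinearMap.proj i : (Fin n → F2) →ₗ[F2] F2) = ⊤ :=
    LinearMap.range_eq_top.2 (LinearMap.proj_surjective i)
  rw [hs, finrank_top, Module.finrank_self, Module.finrank_fin_fun] at h
  rw [hyp, AffineSubspace.direction_mk']
  omega

theorem cov_cons (n : ℕ) (H : Multiset (AffineSubspace F2 (Fin n → F2)))
    (S : AffineSubspace F2 (Fin n → F2)) (x : Fin n → F2) :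
    covCount n (S ::ₘ H) x = covCount n H x + if x ∈ S then 1 else 0 := by
  simp [covCount, Multiset.countP_cons]

theorem cover_step (n k : ℕ) (hn : 1 ≤ n) (H : Multiset (AffineSubspace F2 (Fin n → F2)))
    (h : IsCover n k 1 H) :
    ∃ H', IsCover n (k + 1) 1 H' ∧ Multiset.card H' = Multiset.card H + 2 := by
  obtain ⟨h1, h2, h3⟩ := h
  let i : Fin n := ⟨0, hn⟩
  have key : ∀ x, covCount n (hyp n i 0 ::ₘ hyp n i 1 ::ₘ H) x = covCount n H x + 1 := by
    intro x
    rw [cov_cons, cov_cons, mem_hyp, mem_hyp]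
    rcases f2_cases (x i) with hc | hc <;> simp [hc]
  refine ⟨hyp n i 0 ::ₘ hyp n i 1 ::ₘ H, ⟨?_, ?_, ?_⟩, by simp⟩
  · intro S hS
    simp only [Multiset.mem_cons] at hS
    rcases hS with rfl | rfl | hS
    · exact hyp_ok n i 0
    · exact hyp_ok n i 1
    · exact h1 S hS
  · intro x hx
    rw [key]
    have := h2 x hx
    omega
  · rw [key]
    omega

theorem cover_exists (n k : ℕ) (hn : 1 ≤ n) : ∃ H, IsCover n (k + 1) 1 H := by
  induction k with
  | succ k ih =>
    obtain ⟨H, h⟩ := ih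
    obtain ⟨H', h', -⟩ := cover_step n _ hn H h
    exact ⟨H', h'⟩
  | zero =>
    refine ⟨Multiset.map (fun i => hyp n i 1) Finset.univ.val, ?_, ?_, ?_⟩
    · intro S hS
      obtain ⟨i, -, rfl⟩ := Multiset.mem_map.1 hS
      exact hyp_ok n i 1
    · intro x hx
      obtain ⟨i, hi⟩ := Function.ne_iff.1 hx
      refine Multiset.countP_pos.2 ⟨hyp n i 1, Multiset.mem_map.2 ⟨i, by simp, rfl⟩, ?_⟩
      rw [mem_hyp]
      exact (f2_cases (x i)).resolve_left hi
    · have : covCount n (Multiset.map (fun i => hyp n i 1) Finset.univ.val) 0 = 0 := by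
        refine Multiset.countP_eq_zero.2 ?_
        intro S hS
        obtain ⟨i, -, rfl⟩ := Multiset.mem_map.1 hS
        simp [mem_hyp]
      omega

theorem f_spec (n k : ℕ) (hn : 1 ≤ n) :
    ∃ H, IsCover n (k + 1) 1 H ∧ Multiset.card H = f n (k + 1) 1 := by
  obtain ⟨H, h⟩ := cover_exists n k hn
  exact Nat.sInf_mem (s := {m | ∃ H, IsCover n (k + 1) 1 H ∧ Multiset.card H = m}) ⟨_, H, h, rfl⟩

theorem f_le (n k : ℕ) (H : Multiset (AffineSubspace F2 (Fin n → F2))) (h : IsCover n k 1 H) :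
    f n k 1 ≤ Multiset.card H :=
  Nat.sInf_le ⟨H, h, rfl⟩

theorem cover_down (n k : ℕ) (hn : 1 ≤ n) (H : Multiset (AffineSubspace F2 (Fin n → F2)))
    (h : IsCover n (k + 2) 1 H) :
    ∃ H', IsCover n (k + 1) 1 H' ∧ Multiset.card H' + 1 = Multiset.card H := by
  obtain ⟨h1, h2, h3⟩ := h
  have hS : ∃ S ∈ H, (0 : Fin n → F2) ∈ S ∨ covCount n H 0 = 0 := by
    by_cases h0 : covCount n H 0 = 0
    · have hx := h2 (Pi.single ⟨0, hn⟩ 1) (by simp)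
      obtain ⟨S, hS, -⟩ := Multiset.countP_pos.1 (lt_of_lt_of_le (Nat.succ_pos _) hx)
      exact ⟨S, hS, Or.inr h0⟩
    · obtain ⟨S, hS, h⟩ := Multiset.countP_pos.1 (Nat.pos_of_ne_zero h0)
      exact ⟨S, hS, Or.inl h⟩
  obtain ⟨S, hS, hS0⟩ := hS
  obtain ⟨H', rfl⟩ := Multiset.exists_cons_of_mem hS
  refine ⟨H', ⟨fun T hT => h1 T (Multiset.mem_cons_of_mem hT), ?_, ?_⟩, by simp⟩
  · intro x hx
    have := h2 x hx
    rw [cov_cons] at this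
    split_ifs at this <;> omega
  · rw [cov_cons] at h3 hS0
    rcases hS0 with hS0 | hS0
    · rw [if_pos hS0] at h3
      omega
    · omega

theorem stmt15 (n k : ℕ) (hn : 1 ≤ n) (hk : 2 ≤ k) :
    f n (k - 1) 1 + 1 ≤ f n k 1 ∧ f n k 1 ≤ f n (k - 1) 1 + 2 := by
  obtain ⟨k, rfl⟩ := Nat.exists_eq_add_of_le' hk
  rw [show k + 2 - 1 = k + 1 from rfl]
  constructor
  · obtain ⟨H, h, hc⟩ := f_spec n (k + 1) hn
    obtain ⟨H', h', hc'⟩ := cover_down n k hn H h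
    have := f_le n _ H' h'
    change _ ≤ f n (k + 1 + 1) 1
    omega
  · obtain ⟨H, h, hc⟩ := f_spec n k hn
    obtain ⟨H', h', hc'⟩ := cover_step n _ hn H h
    have := f_le n _ H' h'
    change f n (k + 1 + 1) 1 ≤ _
    omega
end

section
/- For every integer n ≥ 1, f(n,2,1) = n + 1; that is, the minimum number of affine hyperplanes needed to cover every nonzero point of 𝔽₂ⁿ at least twice while covering the origin at most once is exactly n + 1. -/
open scoped Classical

theorem exists_common_dir (n : ℕ) (H : Multiset (AffineSubspace F2 (Fin n → F2)))
    (hH : ∀ S ∈ H, Module.finrank F2 S.direction = n - 1) :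
    ∃ W : Submodule F2 (Fin n → F2), n ≤ Module.finrank F2 W + Multiset.card H ∧
      ∀ S ∈ H, W ≤ S.direction := by
  induction H using Multiset.induction_on with
  | empty => exact ⟨⊤, by simp, by simp⟩
  | cons S H ih =>
    obtain ⟨W, h1, h2⟩ := ih (fun T hT => hH T (Multiset.mem_cons_of_mem hT))
    have hS := hH S (Multiset.mem_cons_self S H)
    refine ⟨W ⊓ S.direction, ?_, ?_⟩
    · have h3 := Submodule.finrank_sup_add_finrank_inf_eq W S.direction
      have h4 := Submodule.finrank_le (W ⊔ S.direction)
      simp only [Module.finrank_fin_fun] at h4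
      rw [Multiset.card_cons]
      omega
    · intro T hT
      rcases Multiset.mem_cons.1 hT with rfl | hT
      · exact inf_le_right
      · exact inf_le_left.trans (h2 T hT)

theorem zero_mem_of_mem_dir (n : ℕ) (S : AffineSubspace F2 (Fin n → F2)) (x : Fin n → F2)
    (hx : x ∈ S) (hd : x ∈ S.direction) : (0 : Fin n → F2) ∈ S := by
  have := AffineSubspace.vadd_mem_of_mem_direction (neg_mem hd) hx
  simpa using this

theorem cover_lower (n : ℕ) (hn : 1 ≤ n) (H : Multiset (AffineSubspace F2 (Fin n → F2)))
    (hH : IsCover n 2 1 H) : n + 1 ≤ Multiset.card H := by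
  obtain ⟨h1, h2, h3⟩ := hH
  by_contra hlt
  -- remove one member so that the rest avoid the origin
  have key : ∃ S0 H', H = S0 ::ₘ H' ∧ ∀ S ∈ H', (0 : Fin n → F2) ∉ S := by
    by_cases h0 : ∃ S ∈ H, (0 : Fin n → F2) ∈ S
    · obtain ⟨S0, hS0, hz⟩ := h0
      obtain ⟨H', rfl⟩ := Multiset.exists_cons_of_mem hS0
      refine ⟨S0, H', rfl, ?_⟩
      intro S hS hc
      unfold covCount at h3
      rw [Multiset.countP_cons, if_pos hz] at h3
      have : 0 < Multiset.countP (fun S => (0 : Fin n → F2) ∈ S) H' :=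
        Multiset.countP_pos.2 ⟨S, hS, hc⟩
      omega
    · push Not at h0
      rcases H.empty_or_exists_mem with rfl | ⟨S0, hS0⟩
      · exfalso
        have := h2 (fun _ => 1) (fun h => one_ne_zero (congrFun h ⟨0, hn⟩))
        simp [covCount] at this
      · obtain ⟨H', rfl⟩ := Multiset.exists_cons_of_mem hS0
        exact ⟨S0, H', rfl, fun S hS => h0 S (Multiset.mem_cons_of_mem hS)⟩
  obtain ⟨S0, H', rfl, hav⟩ := key
  rw [Multiset.card_cons] at hlt
  obtain ⟨W, hW1, hW2⟩ := exists_common_dir n H'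
    (fun S hS => (h1 S (Multiset.mem_cons_of_mem hS)).2)
  have hWne : W ≠ ⊥ := by
    rintro rfl
    rw [finrank_bot] at hW1
    omega
  obtain ⟨x, hxW, hx0⟩ := Submodule.exists_mem_ne_zero_of_ne_bot hWne
  have hc := h2 x hx0
  have hz : Multiset.countP (fun S => x ∈ S) H' = 0 :=
    Multiset.countP_eq_zero.2 fun S hS hxS =>
      hav S hS (zero_mem_of_mem_dir n S x hxS (hW2 S hS hxW))
  unfold covCount at hc
  rw [Multiset.countP_cons, hz] at hc
  split_ifs at hc <;> omega

theorem finrank_ker_of_one (n : ℕ) (φ : (Fin n → F2) →ₗ[F2] F2) (v : Fin n → F2)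
    (hv : φ v = 1) : Module.finrank F2 (LinearMap.ker φ) = n - 1 := by
  have h := LinearMap.finrank_range_add_finrank_ker φ
  have hs : LinearMap.range φ = ⊤ := LinearMap.range_eq_top.2
    fun c => ⟨c • v, by simp [hv]⟩
  rw [hs, finrank_top, Module.finrank_self, Module.finrank_fin_fun] at h
  omega

theorem exists_hyp (n : ℕ) (φ : (Fin n → F2) →ₗ[F2] F2) (v : Fin n → F2) (hv : φ v = 1) :
    ∃ S : AffineSubspace F2 (Fin n → F2),
      ((S : Set (Fin n → F2)).Nonempty ∧ Module.finrank F2 S.direction = n - 1) ∧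
      ∀ x, x ∈ S ↔ φ x = 1 := by
  refine ⟨AffineSubspace.mk' v (LinearMap.ker φ), ⟨⟨v, AffineSubspace.self_mem_mk' _ _⟩, ?_⟩, ?_⟩
  · rw [AffineSubspace.direction_mk']
    exact finrank_ker_of_one n φ v hv
  · intro x
    rw [AffineSubspace.mem_mk', LinearMap.mem_ker, vsub_eq_sub, map_sub, hv, sub_eq_zero]

theorem cover_upper (n : ℕ) (hn : 1 ≤ n) :
    ∃ H, IsCover n 2 1 H ∧ Multiset.card H = n + 1 := by
  have e1 : ∀ a : F2, a ≠ 0 → a = 1 := by decide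
  obtain ⟨T, hT1, hT2⟩ := exists_hyp n (∑ i, LinearMap.proj i) (Pi.single ⟨0, hn⟩ 1)
    (by simp [LinearMap.sum_apply])
  have hex := fun i : Fin n => exists_hyp n (LinearMap.proj i) (Pi.single i 1) (by simp)
  choose P hP1 hP2 using hex
  refine ⟨T ::ₘ (Finset.univ : Finset (Fin n)).val.map P, ⟨?_, ?_, ?_⟩, by simp⟩
  · intro S hS
    rcases Multiset.mem_cons.1 hS with rfl | hS
    · exact hT1
    · obtain ⟨i, -, rfl⟩ := Multiset.mem_map.1 hS
      exact hP1 i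
  · intro x hx
    obtain ⟨i, hi⟩ := Function.ne_iff.1 hx
    have hi1 := e1 _ hi
    have hcount : Multiset.countP (fun S => x ∈ S) ((Finset.univ : Finset (Fin n)).val.map P)
        = (Finset.univ.filter fun i => x i = 1).card := by
      rw [Multiset.countP_map]
      simp only [hP2, LinearMap.proj_apply]
      rfl
    unfold covCount
    rw [Multiset.countP_cons, hcount]
    by_cases hj : ∃ j, j ≠ i ∧ x j = 1
    · obtain ⟨j, hji, hj⟩ := hj
      have : 1 < (Finset.univ.filter fun i => x i = 1).card :=
        Finset.one_lt_card.2 ⟨j, by simp [hj], i, by simp [hi1], hji⟩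
      omega
    · push Not at hj
      have hTx : x ∈ T := by
        rw [hT2, LinearMap.sum_apply, Finset.sum_eq_single i]
        · exact hi1
        · intro j _ hji
          by_contra h
          exact hj j hji (e1 _ h)
        · simp
      have : 0 < (Finset.univ.filter fun i => x i = 1).card :=
        Finset.card_pos.2 ⟨i, by simp [hi1]⟩
      rw [if_pos hTx]
      omega
  · have : covCount n (T ::ₘ (Finset.univ : Finset (Fin n)).val.map P) 0 = 0 := by
      refine Multiset.countP_eq_zero.2 ?_
      intro S hS
      rcases Multiset.mem_cons.1 hS with rfl | hS
      · simp [hT2]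
      · obtain ⟨i, -, rfl⟩ := Multiset.mem_map.1 hS
        simp [hP2]
    omega

theorem stmt17 (n : ℕ) (hn : 1 ≤ n) :
    f n 2 1 = n + 1 := by
  apply le_antisymm
  · exact Nat.sInf_le (cover_upper n hn)
  · refine le_csInf ⟨_, cover_upper n hn⟩ ?_
    rintro m ⟨H, hH, rfl⟩
    exact cover_lower n hn H hH
end
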